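/- Let γ₁, γ₂ be two smooth compact curves in ℝ² such that any normal vector n₁ of γ₁ and any normal vector n₂ of γ₂ make an angle bounded below by a fixed constant (quantitative transversality). Let Δ > 0, and for j = 1,2 let f_j : ℝ² → ℂ have Fourier support in the Δ-neighborhood N_Δ(γ_j). Partition N_Δ(γ_j) into Δ-squares s_j. Then ∫_{ℝ²}|f₁ f₂|² ≲ ∑_{s₁, s₂} ∫_{ℝ²} |P_{s₁} f₁ · P_{s₂} f₂|², where P_s f denotes the Fourier restriction of f to s and the implicit constant depends only on the transversality constant. -/

import Mathlib

open MeasureTheory Metric Set FourierTransform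
open scoped ENNReal NNReal Real

noncomputable section

abbrev E2 : Type := EuclideanSpace ℝ (Fin 2)

/-- `f : ℝ² → ℂ` is integrable and its Fourier transform is supported in `S`. -/
def FourierSuppIn2 (f : E2 → ℂ) (S : Set E2) : Prop :=
  Integrable f volume ∧ ∀ ξ : E2, ξ ∉ S → 𝓕 f ξ = 0

/-- Fourier restriction `P_s f` of `f : ℝ² → ℂ` to a set `s ⊆ ℝ²`. -/
def fRes2 (f : E2 → ℂ) (s : Set E2) : E2 → ℂ :=
  𝓕⁻ (s.indicator (𝓕 f))

/-- The `Δ`-square of the standard `Δ`-grid of `ℝ²` indexed by `k ∈ ℤ²`. -/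
def gridSqZ (Δ : ℝ) (k : ℤ × ℤ) : Set E2 :=
  {ξ | ξ 0 ∈ Ico (k.1 * Δ) ((k.1 + 1) * Δ) ∧ ξ 1 ∈ Ico (k.2 * Δ) ((k.2 + 1) * Δ)}

open Convolution SchwartzMap

lemma aux_continuous_fourier {F : E2 → ℂ} (hF : Integrable F) : Continuous (𝓕 F) :=
  VectorFourier.fourierIntegral_continuous Real.continuous_fourierChar
    (by exact continuous_inner) hF

lemma aux_continuous_fourierInv {F : E2 → ℂ} (hF : Integrable F) : Continuous (𝓕⁻ F) := by
  have : 𝓕⁻ F = fun x => 𝓕 F (-x) := by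
    ext x; exact Real.fourierInv_eq_fourier_neg F x
  rw [this]
  exact (aux_continuous_fourier hF).comp continuous_neg

lemma aux_norm_fourier_le (F : E2 → ℂ) (x : E2) : ‖𝓕 F x‖ ≤ ∫ y, ‖F y‖ :=
  VectorFourier.norm_fourierIntegral_le_integral_norm _ _ _ _ _

lemma aux_flip {F G : E2 → ℂ} (hF : Integrable F) (hG : Integrable G) :
    ∫ x, 𝓕 F x * G x = ∫ x, F x * 𝓕 G x := by
  simpa using! VectorFourier.integral_fourierIntegral_smul_eq_flip (L := innerₗ E2)
    Real.continuous_fourierChar continuous_inner hF hG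

lemma aux_flip_inv {F G : E2 → ℂ} (hF : Integrable F) (hG : Integrable G) :
    ∫ x, 𝓕⁻ F x * G x = ∫ x, F x * 𝓕⁻ G x := by
  have h := aux_flip hF hG.comp_neg
  have h1 : ∀ x, 𝓕⁻ G x = 𝓕 (fun y => G (-y)) x := fun x => by
    rw [Real.fourierInv_eq_fourier_comp_neg]
  simp only [h1]
  rw [← h, ← integral_neg_eq_self _ volume]
  simp [Real.fourierInv_eq_fourier_neg]

/-- a.e. equality tested on Schwartz functions -/
lemma aux_ae_eq {f g : E2 → ℂ} (hf : LocallyIntegrable f) (hg : LocallyIntegrable g)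
    (h : ∀ φ : 𝓢(E2, ℂ), ∫ x, φ x * f x = ∫ x, φ x * g x) : f =ᵐ[volume] g := by
  apply ae_eq_of_integral_contDiff_smul_eq hf hg
  intro φ φ_smooth φ_cpt
  have hg₁ : HasCompactSupport (Complex.ofRealCLM ∘ φ) := φ_cpt.comp_left rfl
  have hg₂ : ContDiff ℝ (⊤ : ℕ∞) (Complex.ofRealCLM ∘ φ) := by fun_prop
  simpa using h (hg₁.toSchwartzMap hg₂)

lemma aux_inversion {f : E2 → ℂ} (hf : Integrable f) (hF : Integrable (𝓕 f)) :
    f =ᵐ[volume] 𝓕⁻ (𝓕 f) := by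
  apply aux_ae_eq hf.locallyIntegrable (aux_continuous_fourierInv hF).locallyIntegrable
  intro φ
  have h1 : ∫ x, 𝓕⁻ (φ : E2 → ℂ) x * 𝓕 f x = ∫ x, φ x * 𝓕⁻ (𝓕 f) x :=
    aux_flip_inv φ.integrable hF
  have h2 : ∫ x, 𝓕 ((𝓕⁻ φ : 𝓢(E2, ℂ)) : E2 → ℂ) x * f x
      = ∫ x, (𝓕⁻ φ : 𝓢(E2, ℂ)) x * 𝓕 f x :=
    aux_flip (𝓕⁻ φ : 𝓢(E2, ℂ)).integrable hf
  rw [← h1, ← SchwartzMap.fourierInv_coe, ← h2, ← SchwartzMap.fourier_coe,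
    FourierTransform.fourier_fourierInv_eq]

lemma aux_plancherel {G : E2 → ℂ} (h1 : Integrable G) (h2 : MemLp G 2) :
    eLpNorm (𝓕⁻ G) 2 volume = eLpNorm G 2 volume := by
  set g2 : Lp (α := E2) ℂ 2 volume := 𝓕⁻ (h2.toLp G) with hg2
  have hae : (g2 : E2 → ℂ) =ᵐ[volume] 𝓕⁻ G := by
    apply aux_ae_eq ((Lp.memLp g2).locallyIntegrable (by norm_num))
      (aux_continuous_fourierInv h1).locallyIntegrable
    intro φ
    have e := congrArg (fun T => T φ)
      (MeasureTheory.Lp.fourierInv_toTemperedDistribution_eq (h2.toLp G))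
    simp only [TemperedDistribution.fourierInv_apply,
      MeasureTheory.Lp.toTemperedDistribution_apply, smul_eq_mul] at e
    rw [hg2, ← e, ← aux_flip_inv φ.integrable h1]
    rw [SchwartzMap.fourierInv_coe]
    apply integral_congr_ae
    filter_upwards [h2.coeFn_toLp] with x hx
    rw [hx]
  rw [← eLpNorm_congr_ae hae, ← Lp.enorm_def]
  have : ‖g2‖ₑ = ‖h2.toLp G‖ₑ := by
    have := MeasureTheory.Lp.norm_fourier_eq g2
    rw [hg2, FourierTransform.fourier_fourierInv_eq] at this
    rw [← ofReal_norm, ← ofReal_norm, hg2, this]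
  rw [this, Lp.enorm_def]
  exact eLpNorm_congr_ae h2.coeFn_toLp

lemma aux_eLpNorm_sq (G : E2 → ℂ) :
    (eLpNorm G 2 volume) ^ 2 = ∫⁻ x, (‖G x‖₊ : ℝ≥0∞) ^ 2 := by
  rw [eLpNorm_eq_lintegral_rpow_enorm_toReal (by norm_num) (by norm_num)]
  rw [← ENNReal.rpow_natCast, ← ENNReal.rpow_mul]
  simp [enorm_eq_nnnorm]

/-- integrable, bounded. -/
def Good (F : E2 → ℂ) : Prop := Integrable F ∧ ∃ B : ℝ, ∀ x, ‖F x‖ ≤ B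

lemma Good.memLp {F : E2 → ℂ} (h : Good F) : MemLp F 2 := by
  obtain ⟨h, B, hB⟩ := h
  rw [memLp_two_iff_integrable_sq_norm h.aestronglyMeasurable]
  simp only [sq]
  exact h.norm.bdd_mul h.norm.aestronglyMeasurable (c := B) (Filter.Eventually.of_forall (by simpa using hB))

lemma Good.int_mul {F G : E2 → ℂ} (hF : Good F) (hG : Good G) (x : E2) :
    Integrable (fun t => F t * G (x - t)) := by
  obtain ⟨B, hB⟩ := hG.2
  exact hF.1.mul_bdd (c := B) (hG.1.comp_sub_left x).aestronglyMeasurable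
    (Filter.Eventually.of_forall fun t => hB _)

lemma Good.conv {F G : E2 → ℂ} (hF : Good F) (hG : Good G) :
    Good (fun x => ∫ t, F t * G (x - t)) := by
  constructor
  · exact hF.1.integrable_convolution (ContinuousLinearMap.mul ℂ ℂ) hG.1
  · obtain ⟨B, hB⟩ := hG.2
    refine ⟨∫ t, ‖F t‖ * B, fun x => ?_⟩
    refine norm_integral_le_of_norm_le (hF.1.norm.mul_const B) (Filter.Eventually.of_forall fun t => ?_)
    rw [norm_mul]
    exact mul_le_mul_of_nonneg_left (hB _) (norm_nonneg _)

lemma aux_planch_conv {F G : E2 → ℂ} (hF : Good F) (hG : Good G) :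
    ∫⁻ x : E2, (‖𝓕⁻ F x‖₊ : ℝ≥0∞) ^ 2 * (‖𝓕⁻ G x‖₊ : ℝ≥0∞) ^ 2 =
      ∫⁻ x : E2, (‖∫ t, F t * G (x - t)‖₊ : ℝ≥0∞) ^ 2 := by
  have hc := hF.conv hG
  rw [← aux_eLpNorm_sq, ← aux_plancherel hc.1 hc.memLp, aux_eLpNorm_sq]
  congr 1 with x
  have : 𝓕⁻ (fun x => ∫ t, F t * G (x - t)) x = 𝓕⁻ F x * 𝓕⁻ G x := by
    simp only [Real.fourierInv_eq_fourier_neg]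
    exact Real.fourier_mul_convolution_eq hF.1 hG.1 (-x)
  rw [this, nnnorm_mul, ENNReal.coe_mul, mul_pow]

def wdg (u v : E2) : ℝ := u 0 * v 1 - u 1 * v 0

lemma wdg_le (u v : E2) : |wdg u v| ≤ ‖u‖ * ‖v‖ := by
  apply abs_le_of_sq_le_sq _ (by positivity)
  rw [mul_pow, EuclideanSpace.real_norm_sq_eq, EuclideanSpace.real_norm_sq_eq]
  simp only [Fin.sum_univ_two, wdg]
  nlinarith [sq_nonneg (u 0 * v 0 + u 1 * v 1)]

def wdgL (v : E2) : E2 →L[ℝ] ℝ :=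
  v 1 • EuclideanSpace.proj (𝕜 := ℝ) (0 : Fin 2) - v 0 • EuclideanSpace.proj (𝕜 := ℝ) (1 : Fin 2)

lemma wdgL_apply (u v : E2) : wdgL v u = wdg u v := by
  simp [wdgL, wdg]; ring

lemma wdg_swap (u v : E2) : wdg u v = - wdg v u := by
  simp [wdg]; ring

lemma wdg_neg_left (u v : E2) : wdg (-u) v = - wdg u v := by
  simp [wdg]; ring

lemma wdg_sub_left (u w v : E2) : wdg (u - w) v = wdg u v - wdg w v := by
  simp [wdg]; ring

lemma wdg_self (u : E2) : wdg u u = 0 := by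
  simp [wdg]; ring

lemma wdg_neg_right (u v : E2) : wdg u (-v) = - wdg u v := by
  simp [wdg]; ring

/-- If a functional bounds the derivative norm from below, the same holds for increments. -/
lemma incr_le {γ : ℝ → E2} (hγ : Differentiable ℝ γ) (L : E2 →L[ℝ] ℝ) {m : ℝ} (hm : 0 ≤ m)
    {a b : ℝ} (hab : a ≤ b) (h : ∀ t ∈ Icc a b, m * ‖deriv γ t‖ ≤ L (deriv γ t)) :
    m * ‖γ b - γ a‖ ≤ L (γ b - γ a) := by
  have hd : ∀ t, HasDerivAt (fun t => γ t - γ a) (deriv γ t) t := fun t =>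
    (hγ t).hasDerivAt.sub_const _
  have key := image_norm_le_of_norm_deriv_right_le_deriv_boundary
    (f := fun t => m • (γ t - γ a)) (f' := fun t => m • deriv γ t) (a := a) (b := b)
    (B := fun t => L (γ t - γ a)) (B' := fun t => L (deriv γ t))
    (fun t _ => ((hd t).const_smul m).continuousAt.continuousWithinAt)
    (fun t _ => ((hd t).const_smul m).hasDerivWithinAt) (by simp)
    (fun t => L.hasFDerivAt.comp_hasDerivAt t (hd t))
    (fun t ht => by
      rw [norm_smul, Real.norm_of_nonneg hm]; exact h t (Ico_subset_Icc_self ht))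
    (right_mem_Icc.2 hab)
  simpa [norm_smul, abs_of_nonneg hm] using key

lemma transv {c : ℝ} (hc : 0 < c) {γ₁ γ₂ : ℝ → E2}
    (h1 : ContDiff ℝ (⊤ : ℕ∞) γ₁) (h2 : ContDiff ℝ (⊤ : ℕ∞) γ₂)
    (r1 : ∀ t ∈ Icc (0:ℝ) 1, deriv γ₁ t ≠ 0)
    (r2 : ∀ t ∈ Icc (0:ℝ) 1, deriv γ₂ t ≠ 0)
    (tr : ∀ s ∈ Icc (0:ℝ) 1, ∀ t ∈ Icc (0:ℝ) 1,
        c * (‖deriv γ₁ s‖ * ‖deriv γ₂ t‖) ≤ |wdg (deriv γ₁ s) (deriv γ₂ t)|)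
    {a a' b b' : ℝ} (ha : a ∈ Icc (0:ℝ) 1) (ha' : a' ∈ Icc (0:ℝ) 1)
    (hb : b ∈ Icc (0:ℝ) 1) (hb' : b' ∈ Icc (0:ℝ) 1) :
    c * (‖γ₁ a - γ₁ a'‖ * ‖γ₂ b - γ₂ b'‖) ≤ |wdg (γ₁ a - γ₁ a') (γ₂ b - γ₂ b')| := by
  wlog haa : a' ≤ a generalizing a a'
  · have := this ha' ha (le_of_not_ge haa)
    rw [← neg_sub (γ₁ a') (γ₁ a), wdg_neg_left, abs_neg, norm_neg]; exact this
  wlog hbb : b' ≤ b generalizing b b'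
  · have := this hb' hb (le_of_not_ge hbb)
    rw [← neg_sub (γ₂ b') (γ₂ b), wdg_neg_right, abs_neg, norm_neg]; exact this
  have d1 : Differentiable ℝ γ₁ := h1.differentiable (by simp)
  have d2 : Differentiable ℝ γ₂ := h2.differentiable (by simp)
  have c1 : Continuous (deriv γ₁) := h1.continuous_deriv (by simp)
  have c2 : Continuous (deriv γ₂) := h2.continuous_deriv (by simp)
  -- constant sign
  obtain ⟨e, he, hsgn⟩ : ∃ e : ℝ, |e| = 1 ∧ ∀ s ∈ Icc (0:ℝ) 1, ∀ t ∈ Icc (0:ℝ) 1,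
      c * (‖deriv γ₁ s‖ * ‖deriv γ₂ t‖) ≤ e * wdg (deriv γ₁ s) (deriv γ₂ t) := by
    set W : ℝ × ℝ → ℝ := fun p => wdg (deriv γ₁ p.1) (deriv γ₂ p.2) with hW
    have cW : Continuous W := by
      simp only [hW, wdg]; fun_prop
    have hne : ∀ p ∈ Icc (0:ℝ) 1 ×ˢ Icc (0:ℝ) 1, W p ≠ 0 := by
      rintro ⟨s, t⟩ ⟨hs, ht⟩ h0
      have := tr s hs t ht
      simp only [hW] at h0
      rw [h0, abs_zero] at this
      have p1 := norm_pos_iff.2 (r1 s hs)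
      have p2 := norm_pos_iff.2 (r2 t ht)
      have : 0 < c * (‖deriv γ₁ s‖ * ‖deriv γ₂ t‖) := by positivity
      linarith
    have hpc : IsPreconnected (W '' (Icc (0:ℝ) 1 ×ˢ Icc (0:ℝ) 1)) :=
      ((isPreconnected_Icc).prod isPreconnected_Icc).image _ cW.continuousOn
    have hoc := hpc.ordConnected
    by_cases hp : ∃ p ∈ Icc (0:ℝ) 1 ×ˢ Icc (0:ℝ) 1, 0 < W p
    · refine ⟨1, by simp, fun s hs t ht => ?_⟩
      have : 0 < W (s, t) := by
        by_contra hn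
        obtain ⟨p, hpm, hp⟩ := hp
        obtain ⟨q, hq, hq0⟩ := hoc.out ⟨(s, t), ⟨hs, ht⟩, rfl⟩ ⟨p, hpm, rfl⟩
          ⟨not_lt.1 hn, hp.le⟩
        exact hne q hq hq0
      have h3 := tr s hs t ht
      rw [abs_of_pos this] at h3
      linarith
    · push Not at hp
      refine ⟨-1, by simp, fun s hs t ht => ?_⟩
      have h3 := tr s hs t ht
      have h4 := hp (s, t) ⟨hs, ht⟩
      rw [abs_of_nonpos h4] at h3
      linarith
  set u := γ₁ a - γ₁ a' with hu
  have s1 : ∀ t ∈ Icc (0:ℝ) 1, c * ‖u‖ * ‖deriv γ₂ t‖ ≤ e * wdg u (deriv γ₂ t) := by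
    intro t ht
    have := incr_le d1 (e • wdgL (deriv γ₂ t)) (m := c * ‖deriv γ₂ t‖) (by positivity) haa
      (fun s hs => by
        have := hsgn s ⟨ha'.1.trans hs.1, hs.2.trans ha.2⟩ t ht
        simp only [_root_.smul_apply, wdgL_apply, smul_eq_mul]
        linarith)
    simp only [_root_.smul_apply, wdgL_apply, smul_eq_mul] at this
    linarith
  have s2 := incr_le d2 ((-e) • wdgL u) (m := c * ‖u‖) (by positivity) hbb
      (fun s hs => by
        have := s1 s ⟨hb'.1.trans hs.1, hs.2.trans hb.2⟩
        simp only [_root_.smul_apply, wdgL_apply, smul_eq_mul]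
        rw [wdg_swap] at this
        linarith)
  simp only [_root_.smul_apply, wdgL_apply, smul_eq_mul] at s2
  rw [wdg_swap, abs_neg]
  calc _ = c * ‖u‖ * ‖γ₂ b - γ₂ b'‖ := by ring
    _ ≤ _ := s2
    _ ≤ |(-e) * wdg (γ₂ b - γ₂ b') u| := le_abs_self _
    _ = _ := by rw [abs_mul, abs_neg, he, one_mul]

/-- If the sums are close, the pieces are close. -/
lemma close_of_sum {c : ℝ} (hc : 0 < c) {u v : E2} (h : c * (‖u‖ * ‖v‖) ≤ |wdg u v|) {r : ℝ}
    (hr : ‖u + v‖ ≤ r) : ‖u‖ ≤ r / c + r := by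
  have hr0 : 0 ≤ r := (norm_nonneg _).trans hr
  rcases eq_or_ne v 0 with rfl | hv
  · have : 0 ≤ r / c := by positivity
    simp at hr; linarith
  have hv' := norm_pos_iff.2 hv
  have h1 : wdg u v = wdg (u + v) v := by simp [wdg]; ring
  have h2 : c * (‖u‖ * ‖v‖) ≤ r * ‖v‖ := by
    rw [h1] at h
    exact h.trans ((wdg_le _ _).trans (by gcongr))
  have h3 : c * ‖u‖ ≤ r := by
    rw [← mul_assoc] at h2
    exact le_of_mul_le_mul_right h2 hv'
  have : ‖u‖ ≤ r / c := by rw [le_div_iff₀ hc]; linarith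
  linarith

lemma mem_grid {Δ : ℝ} (hΔ : 0 < Δ) (k : ℤ × ℤ) (ξ : E2) :
    ξ ∈ gridSqZ Δ k ↔ k = (⌊ξ 0 / Δ⌋, ⌊ξ 1 / Δ⌋) := by
  have aux : ∀ (n : ℤ) (x : ℝ), x ∈ Ico (n * Δ) ((n + 1) * Δ) ↔ n = ⌊x / Δ⌋ := by
    intro n x
    rw [eq_comm, Int.floor_eq_iff, le_div_iff₀ hΔ, div_lt_iff₀ hΔ, mem_Ico]
  rw [Prod.ext_iff, ← aux, ← aux]; rfl

lemma meas_grid (Δ : ℝ) (k : ℤ × ℤ) : MeasurableSet (gridSqZ Δ k) := by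
  have m0 : Measurable (fun ξ : E2 => ξ 0) := by fun_prop
  have m1 : Measurable (fun ξ : E2 => ξ 1) := by fun_prop
  exact (m0 measurableSet_Ico).inter (m1 measurableSet_Ico)

lemma coord_le (u : E2) (i : Fin 2) : |u i| ≤ ‖u‖ := by
  simpa using PiLp.norm_apply_le u i

/-- floors of close numbers are close -/
lemma floor_close {Δ K : ℝ} (hΔ : 0 < Δ) {x y : ℝ} (h : |x - y| ≤ K * Δ) :
    ⌊x / Δ⌋ ∈ Finset.Icc (⌊y / Δ⌋ - ⌈K + 1⌉) (⌊y / Δ⌋ + ⌈K + 1⌉) := by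
  have h1 : |x / Δ - y / Δ| ≤ K := by
    rw [← sub_div, abs_div, abs_of_pos hΔ, div_le_iff₀ hΔ]; exact h
  obtain ⟨h2, h3⟩ := abs_le.1 h1
  have a1 := Int.floor_le (x / Δ)
  have a2 := Int.lt_floor_add_one (x / Δ)
  have b1 := Int.floor_le (y / Δ)
  have b2 := Int.lt_floor_add_one (y / Δ)
  have k1 := Int.le_ceil (K + 1)
  rw [Finset.mem_Icc]
  constructor
  · have : (⌊y / Δ⌋ : ℝ) - ⌈K + 1⌉ ≤ ⌊x / Δ⌋ := by linarith
    exact_mod_cast this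
  · have : (⌊x / Δ⌋ : ℝ) ≤ ⌊y / Δ⌋ + ⌈K + 1⌉ := by linarith
    exact_mod_cast this

/-- finite decomposition -/
lemma exists_finset {Δ : ℝ} (hΔ : 0 < Δ) {F : E2 → ℂ} {S : Set E2} (hS : Bornology.IsBounded S)
    (hF : ∀ ξ, ξ ∉ S → F ξ = 0) :
    ∃ s : Finset (ℤ × ℤ), ∀ ξ, F ξ = ∑ k ∈ s, (gridSqZ Δ k).indicator F ξ := by
  obtain ⟨R, hR⟩ := hS.exists_norm_le
  set M := ⌈R / Δ + 1⌉
  refine ⟨Finset.Icc (0 - M) (0 + M) ×ˢ Finset.Icc (0 - M) (0 + M), fun ξ => ?_⟩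
  by_cases hξ : F ξ = 0
  · rw [hξ, Finset.sum_eq_zero]
    intro k _
    simp [hξ]
  have hm : ξ ∈ S := by by_contra h; exact hξ (hF ξ h)
  have hb : ∀ i, ⌊ξ i / Δ⌋ ∈ Finset.Icc (0 - M) (0 + M) := by
    intro i
    have := floor_close (K := R / Δ) hΔ (x := ξ i) (y := 0) (by
      rw [div_mul_cancel₀ _ hΔ.ne', sub_zero]; exact (coord_le ξ i).trans (hR ξ hm))
    simpa [M] using this
  rw [Finset.sum_eq_single (⌊ξ 0 / Δ⌋, ⌊ξ 1 / Δ⌋)]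
  · rw [Set.indicator_of_mem ((mem_grid hΔ _ _).2 rfl)]
  · intro k _ hk
    rw [Set.indicator_of_notMem]
    rwa [mem_grid hΔ]
  · intro h
    exact absurd (Finset.mem_product.2 ⟨hb 0, hb 1⟩) h

lemma Good.indicator {F : E2 → ℂ} (h : Good F) {s : Set E2} (hs : MeasurableSet s) :
    Good (s.indicator F) := by
  obtain ⟨h, B, hB⟩ := h
  exact ⟨h.indicator hs, B, fun x => (norm_indicator_le_norm_self F x).trans (hB x)⟩

lemma good_fourier {f : E2 → ℂ} {S : Set E2} (hS : IsCompact S) (hf : FourierSuppIn2 f S) :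
    Good (𝓕 f) := by
  refine ⟨?_, _, aux_norm_fourier_le f⟩
  have hc := aux_continuous_fourier hf.1
  exact hc.integrable_of_hasCompactSupport (HasCompactSupport.intro hS hf.2)

lemma exists_near {γ : ℝ → E2} (hγ : Continuous γ) {Δ : ℝ} (hΔ : 0 < Δ) {η : E2}
    (h : η ∈ cthickening Δ (γ '' Icc (0:ℝ) 1)) : ∃ a ∈ Icc (0:ℝ) 1, ‖η - γ a‖ ≤ Δ := by
  have hcpt : IsCompact (γ '' Icc (0:ℝ) 1) := isCompact_Icc.image hγ
  rw [hcpt.cthickening_eq_biUnion_closedBall hΔ.le] at h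
  simp only [mem_iUnion, mem_image, exists_prop] at h
  obtain ⟨_, ⟨a, ha, rfl⟩, h⟩ := h
  exact ⟨a, ha, by rwa [mem_closedBall, dist_eq_norm] at h⟩

lemma card_box (k : ℤ × ℤ) (M : ℤ) :
    (Finset.Icc (k.1 - M) (k.1 + M) ×ˢ Finset.Icc (k.2 - M) (k.2 + M)).card
      = (2 * M + 1).toNat * (2 * M + 1).toNat := by
  rw [Finset.card_product, Int.card_Icc, Int.card_Icc]
  congr 2 <;> ring

lemma sq_sum_le {ι : Type*} (s : Finset ι) (H : ι → ℂ) (N : ℕ)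
    (hN : (s.filter (fun i => H i ≠ 0)).card ≤ N) :
    (‖∑ i ∈ s, H i‖₊ : ℝ≥0∞) ^ 2 ≤ N * ∑ i ∈ s, (‖H i‖₊ : ℝ≥0∞) ^ 2 := by
  have key : ‖∑ i ∈ s, H i‖ ^ 2 ≤ N * ∑ i ∈ s, ‖H i‖ ^ 2 := by
    rw [← Finset.sum_filter_ne_zero]
    calc ‖∑ i ∈ s.filter (fun i => H i ≠ 0), H i‖ ^ 2
        ≤ (∑ i ∈ s.filter (fun i => H i ≠ 0), ‖H i‖) ^ 2 := by
          gcongr; exact norm_sum_le _ _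
      _ ≤ (s.filter (fun i => H i ≠ 0)).card * ∑ i ∈ s.filter (fun i => H i ≠ 0), ‖H i‖ ^ 2 :=
          sq_sum_le_card_mul_sum_sq
      _ ≤ N * ∑ i ∈ s, ‖H i‖ ^ 2 := by
          gcongr
          exact Finset.filter_subset _ _
  have : ‖∑ i ∈ s, H i‖₊ ^ 2 ≤ N * ∑ i ∈ s, ‖H i‖₊ ^ 2 := by
    rw [← NNReal.coe_le_coe]; push_cast; exact key
  exact_mod_cast this

theorem bilinear_restriction_plane (c : ℝ) (hc : 0 < c) :
    ∃ C₀ > (0:ℝ), ∀ γ₁ γ₂ : ℝ → E2,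
      ContDiff ℝ (⊤ : ℕ∞) γ₁ → ContDiff ℝ (⊤ : ℕ∞) γ₂ →
      (∀ t ∈ Icc (0:ℝ) 1, deriv γ₁ t ≠ 0) →
      (∀ t ∈ Icc (0:ℝ) 1, deriv γ₂ t ≠ 0) →
      -- transversality of all pairs of normal vectors (equivalently, of tangent vectors):
      (∀ s ∈ Icc (0:ℝ) 1, ∀ t ∈ Icc (0:ℝ) 1,
        c * (‖deriv γ₁ s‖ * ‖deriv γ₂ t‖) ≤
          |deriv γ₁ s 0 * deriv γ₂ t 1 - deriv γ₁ s 1 * deriv γ₂ t 0|) →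
    ∀ Δ : ℝ, 0 < Δ → ∀ f₁ f₂ : E2 → ℂ,
      FourierSuppIn2 f₁ (cthickening Δ (γ₁ '' Icc (0:ℝ) 1)) →
      FourierSuppIn2 f₂ (cthickening Δ (γ₂ '' Icc (0:ℝ) 1)) →
      ∫⁻ x : E2, (‖f₁ x‖₊ : ℝ≥0∞) ^ 2 * (‖f₂ x‖₊ : ℝ≥0∞) ^ 2 ≤
        ENNReal.ofReal C₀ *
          ∑' k₁ : ℤ × ℤ, ∑' k₂ : ℤ × ℤ,
            ∫⁻ x : E2,
              (‖fRes2 f₁ (gridSqZ Δ k₁) x‖₊ : ℝ≥0∞) ^ 2 *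
              (‖fRes2 f₂ (gridSqZ Δ k₂) x‖₊ : ℝ≥0∞) ^ 2 := by
  set K : ℝ := 4 / c + 6 with hK
  set M : ℤ := ⌈K + 1⌉ with hM
  set N : ℕ := ((2 * M + 1).toNat * (2 * M + 1).toNat) *
    ((2 * M + 1).toNat * (2 * M + 1).toNat) with hN
  have hM0 : 0 < M := by
    rw [hM, Int.ceil_pos]; positivity
  have hN0 : 0 < N := by
    have : 0 < (2 * M + 1).toNat := by omega
    positivity
  refine ⟨N, by exact_mod_cast hN0, ?_⟩
  intro γ₁ γ₂ h1 h2 r1 r2 tr Δ hΔ f₁ f₂ hf₁ hf₂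
  have cpt1 : IsCompact (cthickening Δ (γ₁ '' Icc (0:ℝ) 1)) :=
    (isCompact_Icc.image h1.continuous).cthickening
  have cpt2 : IsCompact (cthickening Δ (γ₂ '' Icc (0:ℝ) 1)) :=
    (isCompact_Icc.image h2.continuous).cthickening
  have g1 := good_fourier cpt1 hf₁
  have g2 := good_fourier cpt2 hf₂
  obtain ⟨S₁, hS₁⟩ := exists_finset hΔ cpt1.isBounded hf₁.2
  obtain ⟨S₂, hS₂⟩ := exists_finset hΔ cpt2.isBounded hf₂.2
  have inv1 := aux_inversion hf₁.1 g1.1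
  have inv2 := aux_inversion hf₂.1 g2.1
  set F₁ := 𝓕 f₁ with hF₁
  set F₂ := 𝓕 f₂ with hF₂
  have gk1 : ∀ k, Good ((gridSqZ Δ k).indicator F₁) := fun k => g1.indicator (meas_grid Δ k)
  have gk2 : ∀ k, Good ((gridSqZ Δ k).indicator F₂) := fun k => g2.indicator (meas_grid Δ k)
  set H : (ℤ × ℤ) × (ℤ × ℤ) → E2 → ℂ := fun p x =>
    ∫ t, (gridSqZ Δ p.1).indicator F₁ t * (gridSqZ Δ p.2).indicator F₂ (x - t) with hH
  have hsum : ∀ x, ∫ t, F₁ t * F₂ (x - t) = ∑ p ∈ S₁ ×ˢ S₂, H p x := by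
    intro x
    simp only [hH]
    rw [← integral_finsetSum _ (fun p _ => (gk1 p.1).int_mul (gk2 p.2) x)]
    congr 1 with t
    rw [hS₁ t, hS₂ (x - t), Finset.sum_mul_sum, Finset.sum_product]
  -- each non-vanishing term comes from a point of the neighborhoods
  have hpt : ∀ x p, H p x ≠ 0 → ∃ η a b, a ∈ Icc (0:ℝ) 1 ∧ b ∈ Icc (0:ℝ) 1 ∧
      ‖η - γ₁ a‖ ≤ Δ ∧ ‖(x - η) - γ₂ b‖ ≤ Δ ∧
      p = ((⌊η 0 / Δ⌋, ⌊η 1 / Δ⌋), (⌊(x - η) 0 / Δ⌋, ⌊(x - η) 1 / Δ⌋)) := by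
    intro x p hp
    obtain ⟨η, hη⟩ : ∃ t, (gridSqZ Δ p.1).indicator F₁ t *
        (gridSqZ Δ p.2).indicator F₂ (x - t) ≠ 0 := by
      by_contra hcon
      push Not at hcon
      apply hp
      simp only [hH, hcon, integral_zero]
    have e1 := left_ne_zero_of_mul hη
    have e2 := right_ne_zero_of_mul hη
    have m1 := (mem_grid hΔ _ _).1 (Set.mem_of_indicator_ne_zero e1)
    have m2 := (mem_grid hΔ _ _).1 (Set.mem_of_indicator_ne_zero e2)
    have n1 : F₁ η ≠ 0 := fun h => e1 (by simp [h])
    have n2 : F₂ (x - η) ≠ 0 := fun h => e2 (by classical rw [Set.indicator_apply, h, ite_self])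
    obtain ⟨a, ha, ha'⟩ := exists_near h1.continuous hΔ
      (by by_contra h; exact n1 (hf₁.2 η h))
    obtain ⟨b, hb, hb'⟩ := exists_near h2.continuous hΔ
      (by by_contra h; exact n2 (hf₂.2 (x - η) h))
    exact ⟨η, a, b, ha, hb, ha', hb', Prod.ext m1 m2⟩
  have hcard : ∀ x, ((S₁ ×ˢ S₂).filter (fun p => H p x ≠ 0)).card ≤ N := by
    intro x
    rcases Finset.eq_empty_or_nonempty ((S₁ ×ˢ S₂).filter (fun p => H p x ≠ 0)) with he | ⟨q, hq⟩
    · rw [he]; simp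
    obtain ⟨η', a', b', ha', hb', na', nb', rfl⟩ := hpt x q (Finset.mem_filter.1 hq).2
    set q1 : ℤ × ℤ := (⌊η' 0 / Δ⌋, ⌊η' 1 / Δ⌋) with hq1
    set q2 : ℤ × ℤ := (⌊(x - η') 0 / Δ⌋, ⌊(x - η') 1 / Δ⌋) with hq2
    have hsub : (S₁ ×ˢ S₂).filter (fun p => H p x ≠ 0) ⊆
        (Finset.Icc (q1.1 - M) (q1.1 + M) ×ˢ Finset.Icc (q1.2 - M) (q1.2 + M)) ×ˢ
        (Finset.Icc (q2.1 - M) (q2.1 + M) ×ˢ Finset.Icc (q2.2 - M) (q2.2 + M)) := by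
      intro p hp
      obtain ⟨η, a, b, ha, hb, na, nb, rfl⟩ := hpt x p (Finset.mem_filter.1 hp).2
      have ht := transv hc h1 h2 r1 r2 tr ha ha' hb hb'
      have hs : ‖(γ₁ a - γ₁ a') + (γ₂ b - γ₂ b')‖ ≤ 4 * Δ := by
        have : (γ₁ a - γ₁ a') + (γ₂ b - γ₂ b') =
          ((η' - γ₁ a') + ((x - η') - γ₂ b')) - ((η - γ₁ a) + ((x - η) - γ₂ b)) := by abel
        rw [this]
        have i1 := norm_sub_le ((η' - γ₁ a') + ((x - η') - γ₂ b')) ((η - γ₁ a) + ((x - η) - γ₂ b))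
        have i2 := norm_add_le (η' - γ₁ a') ((x - η') - γ₂ b')
        have i3 := norm_add_le (η - γ₁ a) ((x - η) - γ₂ b)
        linarith
      have hu := close_of_sum hc ht hs
      have hd : ‖η - η'‖ ≤ K * Δ := by
        have : η - η' = (γ₁ a - γ₁ a') + ((η - γ₁ a) - (η' - γ₁ a')) := by abel
        rw [this]
        have i1 := norm_add_le (γ₁ a - γ₁ a') ((η - γ₁ a) - (η' - γ₁ a'))
        have i2 := norm_sub_le (η - γ₁ a) (η' - γ₁ a')
        have i3 : K * Δ = 4 * Δ / c + 4 * Δ + 2 * Δ := by rw [hK]; ring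
        linarith
      have c1 : ∀ i, |η i - η' i| ≤ K * Δ := fun i => (coord_le (η - η') i).trans hd
      have c2 : ∀ i, |(x - η) i - (x - η') i| ≤ K * Δ := fun i => by
        have : (x - η) i - (x - η') i = -(η i - η' i) := by simp
        rw [this, abs_neg]; exact c1 i
      exact Finset.mem_product.2 ⟨Finset.mem_product.2 ⟨floor_close hΔ (c1 0), floor_close hΔ (c1 1)⟩,
        Finset.mem_product.2 ⟨floor_close hΔ (c2 0), floor_close hΔ (c2 1)⟩⟩
    refine (Finset.card_le_card hsub).trans ?_
    rw [Finset.card_product, card_box, card_box]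
  have hmeas : ∀ p, AEMeasurable (fun x => (‖H p x‖₊ : ℝ≥0∞) ^ 2) volume := fun p =>
    ((gk1 p.1).conv (gk2 p.2)).1.aestronglyMeasurable.aemeasurable.nnnorm.coe_nnreal_ennreal.pow_const 2
  calc ∫⁻ x : E2, (‖f₁ x‖₊ : ℝ≥0∞) ^ 2 * (‖f₂ x‖₊ : ℝ≥0∞) ^ 2
      = ∫⁻ x : E2, (‖𝓕⁻ F₁ x‖₊ : ℝ≥0∞) ^ 2 * (‖𝓕⁻ F₂ x‖₊ : ℝ≥0∞) ^ 2 := by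
        apply lintegral_congr_ae
        filter_upwards [inv1, inv2] with x e1 e2
        rw [e1, e2]
    _ = ∫⁻ x : E2, (‖∑ p ∈ S₁ ×ˢ S₂, H p x‖₊ : ℝ≥0∞) ^ 2 := by
        rw [aux_planch_conv g1 g2]
        simp only [hsum]
    _ ≤ ∫⁻ x : E2, N * ∑ p ∈ S₁ ×ˢ S₂, (‖H p x‖₊ : ℝ≥0∞) ^ 2 :=
        lintegral_mono fun x => sq_sum_le _ _ _ (hcard x)
    _ = N * ∑ p ∈ S₁ ×ˢ S₂, ∫⁻ x : E2, (‖H p x‖₊ : ℝ≥0∞) ^ 2 := by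
        rw [lintegral_const_mul' _ _ (by simp), lintegral_finsetSum' _ (fun p _ => hmeas p)]
    _ = N * ∑ k₁ ∈ S₁, ∑ k₂ ∈ S₂, ∫⁻ x : E2,
              (‖fRes2 f₁ (gridSqZ Δ k₁) x‖₊ : ℝ≥0∞) ^ 2 *
              (‖fRes2 f₂ (gridSqZ Δ k₂) x‖₊ : ℝ≥0∞) ^ 2 := by
        rw [Finset.sum_product]
        congr 1
        refine Finset.sum_congr rfl fun k₁ _ => Finset.sum_congr rfl fun k₂ _ => ?_
        exact (aux_planch_conv (gk1 k₁) (gk2 k₂)).symm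
    _ ≤ _ := by
        rw [ENNReal.ofReal_natCast]
        gcongr
        refine le_trans ?_ (ENNReal.sum_le_tsum S₁)
        exact Finset.sum_le_sum fun k₁ _ => ENNReal.sum_le_tsum S₂
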